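/- arXiv:1503.08373 — 2 statements merged into one kernel-verified Lean document; each statement's English description precedes it below -/
import Mathlib

section
/- Let E be a complex Banach space, let k ≥ 0 be an integer and 0 < σ < 1. Let f : ℝ → E be of class C^k, such that each derivative f^(j) (0 ≤ j ≤ k) is Bochner integrable on ℝ, and suppose there is a constant K ≥ 0 such that ∫_ℝ ‖f^(k)(τ+h) − f^(k)(τ)‖ dτ ≤ K·|h|^σ for every real h ≠ 0. Then there exists a constant C = C(k,σ) > 0, independent of f, such that for every t ∈ ℝ: ‖∫_ℝ f(τ)·e^{iτt} dτ‖ ≤ C·(1+|t|)^{−(k+σ)} · ( Σ_{j=0}^{k} ∫_ℝ ‖f^(j)(τ)‖ dτ + K ). -/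
open MeasureTheory

section FourierDecay

variable {E : Type*} [NormedAddCommGroup E] [NormedSpace ℂ E]

lemma norm_exp_I_mul_mul (τ t : ℝ) : ‖Complex.exp (Complex.I * τ * t)‖ = 1 := by
  rw [show Complex.I * τ * t = ((τ * t : ℝ) : ℂ) * Complex.I by push_cast; ring]
  exact Complex.norm_exp_ofReal_mul_I _

lemma norm_integral_exp_smul_le (g : ℝ → E) (t : ℝ) :
    ‖∫ τ : ℝ, Complex.exp (Complex.I * τ * t) • g τ‖ ≤ ∫ τ : ℝ, ‖g τ‖ := by
  refine (norm_integral_le_integral_norm _).trans_eq ?_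
  simp only [norm_smul, norm_exp_I_mul_mul, one_mul]

lemma integral_exp_smul_eq_fourier (g : ℝ → E) (t : ℝ) :
    ∫ τ : ℝ, Complex.exp (Complex.I * τ * t) • g τ =
      FourierTransform.fourier g (-(t / (2 * Real.pi))) := by
  rw [Real.fourier_real_eq_integral_exp_smul]
  congr 1 with τ
  congr 2
  have : (Real.pi : ℂ) ≠ 0 := by exact_mod_cast Real.pi_ne_zero
  push_cast
  field_simp

lemma norm_integral_exp_smul_iteratedDeriv {k : ℕ} {f : ℝ → E} (hf : ContDiff ℝ (k : ℕ∞) f)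
    (hint : ∀ j ≤ k, Integrable (iteratedDeriv j f)) (t : ℝ) :
    ‖∫ τ : ℝ, Complex.exp (Complex.I * τ * t) • iteratedDeriv k f τ‖ =
      |t| ^ k * ‖∫ τ : ℝ, Complex.exp (Complex.I * τ * t) • f τ‖ := by
  rw [integral_exp_smul_eq_fourier, integral_exp_smul_eq_fourier,
    Real.fourier_iteratedDeriv hf (fun n hn => hint n (by exact_mod_cast hn)) le_rfl]
  have hpi : (Real.pi : ℂ) ≠ 0 := by exact_mod_cast Real.pi_ne_zero
  have h : 2 * (Real.pi : ℂ) * Complex.I * ((-(t / (2 * Real.pi)) : ℝ) : ℂ) =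
      -(Complex.I * t) := by
    push_cast
    field_simp
  simp only [h, norm_smul, norm_pow, norm_neg, norm_mul, Complex.norm_I, one_mul,
    Complex.norm_real, Real.norm_eq_abs]

lemma two_mul_norm_integral_exp_smul_le {g : ℝ → E} (hg : Integrable g) {t : ℝ} (ht : t ≠ 0) :
    2 * ‖∫ τ : ℝ, Complex.exp (Complex.I * τ * t) • g τ‖ ≤
      ∫ τ : ℝ, ‖g (τ + Real.pi / t) - g τ‖ := by
  have hexp : Continuous fun τ : ℝ => Complex.exp (Complex.I * τ * t) := by fun_prop
  have hmul {u : ℝ → E} (hu : Integrable u) :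
      Integrable fun τ : ℝ => Complex.exp (Complex.I * τ * t) • u τ :=
    hu.bdd_smul 1 hexp.aestronglyMeasurable
      (Filter.Eventually.of_forall fun τ => (norm_exp_I_mul_mul τ t).le)
  have hshift : ∫ τ : ℝ, Complex.exp (Complex.I * τ * t) • g (τ + Real.pi / t) =
      -∫ τ : ℝ, Complex.exp (Complex.I * τ * t) • g τ := by
    rw [← integral_add_right_eq_self
      (fun τ : ℝ => Complex.exp (Complex.I * τ * t) • g τ) (Real.pi / t), ← integral_neg]
    congr 1 with τ
    have htc : (t : ℂ) ≠ 0 := by exact_mod_cast ht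
    rw [show Complex.I * ((τ + Real.pi / t : ℝ) : ℂ) * t =
        Complex.I * τ * t + Real.pi * Complex.I by push_cast; field_simp,
      Complex.exp_add, Complex.exp_pi_mul_I]
    simp
  have key := norm_integral_exp_smul_le (fun τ => g (τ + Real.pi / t) - g τ) t
  simp only [smul_sub] at key
  rw [integral_sub (hmul (hg.comp_add_right _)) (hmul hg), hshift, ← neg_add', norm_neg,
    ← two_smul ℝ, norm_smul] at key
  simpa using key

end FourierDecay

/-- Shibata-type Fourier decay lemma (case `0 < σ < 1`): if `f : ℝ → E` is `C^k` with all
derivatives up to order `k` integrable and the `k`-th derivative has an `L¹` Hölder modulus of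
continuity of order `σ`, then the Fourier-type integral `∫ f(τ) e^{iτt} dτ` decays like
`(1+|t|)^{-(k+σ)}`, with a constant depending only on `k` and `σ`. -/
theorem stmt_0 (E : Type*) [NormedAddCommGroup E] [NormedSpace ℂ E] [CompleteSpace E]
    (k : ℕ) (σ : ℝ) (hσ0 : 0 < σ) (hσ1 : σ < 1) :
    ∃ C : ℝ, 0 < C ∧
      ∀ (f : ℝ → E) (K : ℝ), 0 ≤ K →
        ContDiff ℝ (k : ℕ∞) f →
        (∀ j ≤ k, Integrable (iteratedDeriv j f)) →
        (∀ h : ℝ, h ≠ 0 →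
          (∫ τ : ℝ, ‖iteratedDeriv k f (τ + h) - iteratedDeriv k f τ‖) ≤ K * |h| ^ σ) →
        ∀ t : ℝ,
          ‖∫ τ : ℝ, Complex.exp (Complex.I * τ * t) • f τ‖ ≤
            C * (1 + |t|) ^ (-((k : ℝ) + σ)) *
              ((∑ j ∈ Finset.range (k + 1), ∫ τ : ℝ, ‖iteratedDeriv j f τ‖) + K) := by
  have hpiσ : 0 < Real.pi ^ σ := Real.rpow_pos_of_pos Real.pi_pos σ
  refine ⟨2 ^ ((k : ℝ) + σ) * (Real.pi ^ σ + 1), by positivity, ?_⟩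
  intro f K hK hf hint hmod t
  set S := ∑ j ∈ Finset.range (k + 1), ∫ τ : ℝ, ‖iteratedDeriv j f τ‖
  set F := ‖∫ τ : ℝ, Complex.exp (Complex.I * τ * t) • f τ‖ with hF
  have hS : ∫ τ : ℝ, ‖f τ‖ ≤ S := by
    have := Finset.single_le_sum (f := fun j => ∫ τ : ℝ, ‖iteratedDeriv j f τ‖)
      (fun j _ => integral_nonneg fun τ => norm_nonneg _)
      (Finset.mem_range.2 k.succ_pos)
    simpa using this
  have hS0 : 0 ≤ S := (integral_nonneg fun τ => norm_nonneg _).trans hS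
  have hpow : 2 ^ ((k : ℝ) + σ) * (1 + |t|) ^ (-((k : ℝ) + σ)) =
      (2 / (1 + |t|)) ^ ((k : ℝ) + σ) := by
    rw [Real.rpow_neg (by positivity), Real.div_rpow (by norm_num) (by positivity),
      div_eq_mul_inv]
  rw [mul_right_comm _ (Real.pi ^ σ + 1), hpow, mul_assoc]
  rcases le_total |t| 1 with ht | ht
  · have hone : 1 ≤ (2 / (1 + |t|)) ^ ((k : ℝ) + σ) := by
      refine Real.one_le_rpow ?_ (by positivity)
      rw [le_div_iff₀ (by positivity)]
      linarith
    calc F ≤ S := (norm_integral_exp_smul_le f t).trans hS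
      _ ≤ 1 * ((Real.pi ^ σ + 1) * (S + K)) := by nlinarith [mul_nonneg hpiσ.le (add_nonneg hS0 hK)]
      _ ≤ _ := by gcongr
  · have htpos : 0 < |t| := by linarith
    have ht0 : t ≠ 0 := abs_pos.1 htpos
    have hdecay : 2 * (|t| ^ k * F) ≤ K * (Real.pi ^ σ / |t| ^ σ) := by
      rw [hF, ← norm_integral_exp_smul_iteratedDeriv hf hint]
      refine (two_mul_norm_integral_exp_smul_le (hint k le_rfl) ht0).trans
        ((hmod _ (div_ne_zero Real.pi_ne_zero ht0)).trans_eq ?_)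
      rw [abs_div, abs_of_pos Real.pi_pos, Real.div_rpow Real.pi_pos.le htpos.le]
    have hF' : F ≤ (1 / |t|) ^ ((k : ℝ) + σ) * (K * Real.pi ^ σ) := by
      have hσt : 0 < |t| ^ σ := Real.rpow_pos_of_pos htpos σ
      have hkF : 0 ≤ |t| ^ k * F := by positivity
      rw [Real.div_rpow zero_le_one htpos.le, Real.one_rpow, Real.rpow_add htpos,
        Real.rpow_natCast, one_div_mul_eq_div, le_div_iff₀ (by positivity)]
      calc F * (|t| ^ k * |t| ^ σ) = |t| ^ k * F * |t| ^ σ := by ring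
        _ ≤ K * (Real.pi ^ σ / |t| ^ σ) * |t| ^ σ :=
          mul_le_mul_of_nonneg_right (by linarith) hσt.le
        _ = K * Real.pi ^ σ := by field_simp
    refine hF'.trans ?_
    have hbase : 1 / |t| ≤ 2 / (1 + |t|) := by
      rw [div_le_div_iff₀ htpos (by positivity)]
      linarith
    have hconst : K * Real.pi ^ σ ≤ (Real.pi ^ σ + 1) * (S + K) := by
      nlinarith [mul_nonneg hpiσ.le hS0]
    exact mul_le_mul (Real.rpow_le_rpow (by positivity) hbase (by positivity)) hconst
      (by positivity) (by positivity)
end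

section
/- Let E be a complex Banach space, let p ≥ 1 be an integer, 0 < σ < 1, and I = (−2,2). Let f : ℝ → E be of class C^{p−1} on ℝ with support contained in I, infinitely differentiable on ℝ \ {0}, and suppose there is a constant C₀ ≥ 0 such that for all τ ∈ I \ {0}: ‖f^(j)(τ)‖ ≤ C₀ for j = 0, 1, …, p−1; ‖f^(p)(τ)‖ ≤ C₀·|τ|^{σ−1}; and ‖f^(p+1)(τ)‖ ≤ C₀·|τ|^{σ−2}. Then f^(p) (defined on ℝ \ {0}) is Bochner integrable on ℝ and there exists a constant C = C(p,σ) > 0, independent of f and C₀, such that Σ_{j=0}^{p} ∫_ℝ ‖f^(j)(τ)‖ dτ + sup_{h≠0} |h|^{−σ} ∫_ℝ ‖f^(p)(τ+h) − f^(p)(τ)‖ dτ ≤ C·C₀. -/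
open MeasureTheory Set Filter Topology

lemma integrable_indicator_abs_rpow {r : ℝ} (hr : -1 < r) (a : ℝ) :
    Integrable ((Ioo (-a) a).indicator fun x : ℝ => |x| ^ r) := by
  rw [integrable_indicator_iff measurableSet_Ioo]
  rcases le_total a 0 with ha | ha
  · rw [Ioo_eq_empty (by linarith)]
    exact integrableOn_empty
  have h₁ : IntervalIntegrable (fun x : ℝ => x ^ r) volume (-a) a :=
    intervalIntegral.intervalIntegrable_rpow' hr
  have h₂ : IntervalIntegrable (fun x : ℝ => (-x) ^ r) volume (-a) a := by
    have := (h₁.comp_sub_left 0).symm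
    simpa using this
  rw [intervalIntegrable_iff_integrableOn_Ioo_of_le (by linarith)] at h₁ h₂
  refine (h₁.norm.add h₂.norm).mono'
    (Measurable.aestronglyMeasurable (by fun_prop)) (.of_forall fun x => ?_)
  rw [Real.norm_of_nonneg (by positivity)]
  change |x| ^ r ≤ ‖x ^ r‖ + ‖(-x) ^ r‖
  rcases le_total 0 x with hx | hx
  · rw [abs_of_nonneg hx, Real.norm_of_nonneg (by positivity)]
    exact le_add_of_nonneg_right (norm_nonneg _)
  · rw [abs_of_nonpos hx, Real.norm_of_nonneg (Real.rpow_nonneg (neg_nonneg.2 hx) r)]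
    exact le_add_of_nonneg_left (norm_nonneg _)

/-- Integrable profile that dominates, after rescaling by `h`, the increment `g (τ + h) - g τ` of a
function `g` with `‖g τ‖ ≤ |τ| ^ (σ - 1)` and `‖g' τ‖ ≤ |τ| ^ (σ - 2)`. -/
noncomputable def incrementProfile (σ u : ℝ) : ℝ :=
  (Ioo (-3 : ℝ) 3).indicator (fun x => |x| ^ (σ - 1)) (u + 1) +
    (Ioo (-3 : ℝ) 3).indicator (fun x => |x| ^ (σ - 1)) u + ((1 + |u|) / 4) ^ (σ - 2)

lemma incrementProfile_nonneg (σ u : ℝ) : 0 ≤ incrementProfile σ u := by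
  have h (x : ℝ) : 0 ≤ (Ioo (-3 : ℝ) 3).indicator (fun x => |x| ^ (σ - 1)) x :=
    indicator_nonneg (fun _ _ => by positivity) x
  have := h u
  have := h (u + 1)
  unfold incrementProfile
  positivity

lemma integrable_incrementProfile {σ : ℝ} (hσ0 : 0 < σ) (hσ1 : σ < 1) :
    Integrable (incrementProfile σ) := by
  have h := integrable_indicator_abs_rpow (r := σ - 1) (by linarith) 3
  have hj : Integrable fun u : ℝ => ((1 + |u|) / 4) ^ (σ - 2) := by
    have := (integrable_one_add_norm (E := ℝ) (μ := volume) (r := 2 - σ)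
      (by simp; linarith)).div_const ((4 : ℝ) ^ (σ - 2))
    refine this.congr (.of_forall fun u => ?_)
    simp only [Real.norm_eq_abs, neg_sub]
    rw [Real.div_rpow (by positivity) (by positivity)]
  exact ((h.comp_add_right 1).add h).add hj

section

variable {E : Type*} [NormedAddCommGroup E] [NormedSpace ℝ E]

lemma norm_increment_le_incrementProfile {σ : ℝ} (hσ1 : σ < 1) {g g' : ℝ → E} {C : ℝ} (hC : 0 ≤ C)
    (hg : ∀ t ≠ 0, ‖g t‖ ≤ C * |t| ^ (σ - 1))
    (hg' : ∀ t ≠ 0, ‖g' t‖ ≤ C * |t| ^ (σ - 2))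
    (hd : ∀ t ≠ 0, HasDerivAt g (g' t) t) {h t : ℝ} (hh : h ≠ 0) (ht : t ≠ 0) (hth : t + h ≠ 0) :
    ‖g (t + h) - g t‖ ≤ C * |h| ^ (σ - 1) * incrementProfile σ (h⁻¹ * t) := by
  obtain ⟨u, rfl⟩ : ∃ u, t = h * u := ⟨h⁻¹ * t, by field_simp⟩
  rw [inv_mul_cancel_left₀ hh]
  have hh' : 0 < |h| := abs_pos.2 hh
  have hprof (x : ℝ) : 0 ≤ (Ioo (-3 : ℝ) 3).indicator (fun x => |x| ^ (σ - 1)) x :=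
    indicator_nonneg (fun _ _ => by positivity) x
  rcases lt_or_ge |u| 2 with hu | hu
  · obtain ⟨hu₁, hu₂⟩ := abs_lt.1 hu
    have h₁ := hg _ hth
    have h₂ := hg _ ht
    rw [show h * u + h = h * (u + 1) by ring, abs_mul,
      Real.mul_rpow (abs_nonneg _) (abs_nonneg _)] at h₁
    rw [abs_mul, Real.mul_rpow (abs_nonneg _) (abs_nonneg _)] at h₂
    have h₃ : |u + 1| ^ (σ - 1) + |u| ^ (σ - 1) ≤ incrementProfile σ u := by
      unfold incrementProfile
      rw [indicator_of_mem (by constructor <;> linarith),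
        indicator_of_mem (by constructor <;> linarith)]
      exact le_add_of_nonneg_right (by positivity)
    calc ‖g (h * u + h) - g (h * u)‖ ≤ ‖g (h * u + h)‖ + ‖g (h * u)‖ := norm_sub_le _ _
      _ ≤ C * |h| ^ (σ - 1) * (|u + 1| ^ (σ - 1) + |u| ^ (σ - 1)) := by
        rw [show h * u + h = h * (u + 1) by ring]
        linarith
      _ ≤ _ := by gcongr
  · have hlow : ∀ x ∈ uIcc (h * u) (h * u + h), |h| * ((1 + |u|) / 4) ≤ |x| := fun x hx => by
      have h₁ : |x - h * u| ≤ |h| := by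
        have := abs_sub_left_of_mem_uIcc hx
        simpa using this
      have h₂ : |h| * |u| ≤ |x| + |x - h * u| := by
        rw [← abs_mul]
        have := abs_sub x (x - h * u)
        simpa using this
      nlinarith
    have hne : ∀ x ∈ uIcc (h * u) (h * u + h), x ≠ 0 := fun x hx =>
      abs_pos.1 ((by positivity : (0 : ℝ) < |h| * ((1 + |u|) / 4)).trans_le (hlow x hx))
    have key := Convex.norm_image_sub_le_of_norm_hasDerivWithin_le
      (C := C * (|h| * ((1 + |u|) / 4)) ^ (σ - 2))
      (fun x hx => (hd x (hne x hx)).hasDerivWithinAt)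
      (fun x hx => (hg' x (hne x hx)).trans (mul_le_mul_of_nonneg_left
        (Real.rpow_le_rpow_of_nonpos (by positivity) (hlow x hx) (by linarith)) hC))
      (convex_uIcc _ _) left_mem_uIcc right_mem_uIcc
    refine key.trans ?_
    rw [add_sub_cancel_left, Real.norm_eq_abs, Real.mul_rpow (by positivity) (by positivity),
      show σ - 1 = (σ - 2) + 1 by ring, Real.rpow_add_one hh'.ne']
    have h₃ : ((1 + |u|) / 4) ^ (σ - 2) ≤ incrementProfile σ u :=
      le_add_of_nonneg_left (add_nonneg (hprof _) (hprof _))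
    calc _ = C * (|h| ^ (σ - 2) * |h|) * ((1 + |u|) / 4) ^ (σ - 2) := by ring
      _ ≤ _ := by gcongr

lemma rpow_neg_mul_integral_norm_increment_le {σ : ℝ} (hσ0 : 0 < σ) (hσ1 : σ < 1) {g g' : ℝ → E}
    {C : ℝ} (hC : 0 ≤ C) (hg : ∀ t ≠ 0, ‖g t‖ ≤ C * |t| ^ (σ - 1))
    (hg' : ∀ t ≠ 0, ‖g' t‖ ≤ C * |t| ^ (σ - 2))
    (hd : ∀ t ≠ 0, HasDerivAt g (g' t) t) {h : ℝ} (hh : h ≠ 0) :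
    |h| ^ (-σ) * ∫ t, ‖g (t + h) - g t‖ ≤ (∫ u, incrementProfile σ u) * C := by
  have hh' : 0 < |h| := abs_pos.2 hh
  have hle : ∫ t, ‖g (t + h) - g t‖ ≤
      ∫ t, C * |h| ^ (σ - 1) * incrementProfile σ (h⁻¹ * t) := by
    refine integral_mono_of_nonneg (.of_forall fun _ => norm_nonneg _)
      (((integrable_incrementProfile hσ0 hσ1).comp_mul_left' (inv_ne_zero hh)).const_mul _) ?_
    filter_upwards [Measure.ae_ne volume 0, Measure.ae_ne volume (-h)] with t ht hth
    exact norm_increment_le_incrementProfile hσ1 hC hg hg' hd hh ht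
      fun h0 => hth (eq_neg_of_add_eq_zero_left h0)
  rw [integral_const_mul, Measure.integral_comp_inv_mul_left, smul_eq_mul] at hle
  calc _ ≤ |h| ^ (-σ) * (C * |h| ^ (σ - 1) * (|h| * ∫ u, incrementProfile σ u)) := by gcongr
    _ = (|h| ^ (-σ) * |h| ^ (σ - 1) * |h|) * ((∫ u, incrementProfile σ u) * C) := by ring
    _ = _ := by
      rw [← Real.rpow_add hh', ← Real.rpow_add_one hh'.ne',
        show -σ + (σ - 1) + 1 = 0 by ring, Real.rpow_zero, one_mul]

lemma ContDiffOn.hasDerivAt_iteratedDeriv {f : ℝ → E} {s : Set ℝ} (hs : IsOpen s)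
    (hf : ContDiffOn ℝ (⊤ : ℕ∞) f s) (n : ℕ) {t : ℝ} (ht : t ∈ s) :
    HasDerivAt (iteratedDeriv n f) (iteratedDeriv (n + 1) f t) t := by
  rw [iteratedDeriv_succ]
  have h := hf.differentiableOn_iteratedDerivWithin (m := n)
    (by exact_mod_cast ENat.natCast_lt_top n) hs.uniqueDiffOn
  exact ((h.congr fun x hx => (iteratedDerivWithin_of_isOpen hs hx).symm).differentiableAt
    (hs.mem_nhds ht)).hasDerivAt

lemma iteratedDeriv_eq_zero_of_support_subset_Ioo {f : ℝ → E} {a b : ℝ}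
    (hf : Function.support f ⊆ Ioo a b) {n : ℕ} {t : ℝ} (ht : t ∉ Ioo a b)
    (hc : ContinuousAt (iteratedDeriv n f) t) : iteratedDeriv n f t = 0 := by
  have hz : ∀ s ∈ (Icc a b)ᶜ, iteratedDeriv n f s = 0 := fun s hs => by
    have : f =ᶠ[𝓝 s] fun _ => 0 := by
      filter_upwards [isClosed_Icc.isOpen_compl.mem_nhds hs] with x hx
      exact Function.notMem_support.1 fun h => hx (Ioo_subset_Icc_self (hf h))
    rw [this.iteratedDeriv_eq]
    simp
  rcases le_or_gt t a with hta | hta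
  · refine tendsto_nhds_unique (hc.mono_left nhdsWithin_le_nhds : Tendsto _ (𝓝[<] t) _)
      (tendsto_const_nhds.congr' ?_)
    filter_upwards [self_mem_nhdsWithin] with x (hx : x < t)
    exact (hz x fun h => by linarith [h.1]).symm
  · have htb : b ≤ t := not_lt.1 fun h => ht ⟨hta, h⟩
    refine tendsto_nhds_unique (hc.mono_left nhdsWithin_le_nhds : Tendsto _ (𝓝[>] t) _)
      (tendsto_const_nhds.congr' ?_)
    filter_upwards [self_mem_nhdsWithin] with x (hx : t < x)
    exact (hz x fun h => by linarith [h.2]).symm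

end

/-- First part of the paper's Lemma 2.5 (Shibata): if `f : ℝ → E` is `C^{p-1}` on `ℝ`, supported
in `I = (-2,2)`, smooth away from the origin, with `‖f⁽ʲ⁾‖ ≤ C₀` for `j < p`,
`‖f⁽ᵖ⁾(τ)‖ ≤ C₀|τ|^{σ-1}` and `‖f⁽ᵖ⁺¹⁾(τ)‖ ≤ C₀|τ|^{σ-2}` on `I \ {0}`, then `f⁽ᵖ⁾` is
integrable and the `B^{p+σ}_{1,∞}` norm (sum of `L¹` norms of the derivatives up to order `p`
plus the `L¹` Hölder modulus of `f⁽ᵖ⁾`) is bounded by `C(p,σ)·C₀`. -/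
theorem stmt_2 (E : Type*) [NormedAddCommGroup E] [NormedSpace ℂ E] [CompleteSpace E]
    (p : ℕ) (hp : 1 ≤ p) (σ : ℝ) (hσ0 : 0 < σ) (hσ1 : σ < 1) :
    ∃ C : ℝ, 0 < C ∧
      ∀ (f : ℝ → E) (C₀ : ℝ), 0 ≤ C₀ →
        ContDiff ℝ ((p - 1 : ℕ) : ℕ∞) f →
        Function.support f ⊆ Set.Ioo (-2 : ℝ) 2 →
        ContDiffOn ℝ (⊤ : ℕ∞) f {(0 : ℝ)}ᶜ →
        (∀ j < p, ∀ τ ∈ Set.Ioo (-2 : ℝ) 2 \ {0}, ‖iteratedDeriv j f τ‖ ≤ C₀) →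
        (∀ τ ∈ Set.Ioo (-2 : ℝ) 2 \ {0}, ‖iteratedDeriv p f τ‖ ≤ C₀ * |τ| ^ (σ - 1)) →
        (∀ τ ∈ Set.Ioo (-2 : ℝ) 2 \ {0}, ‖iteratedDeriv (p + 1) f τ‖ ≤ C₀ * |τ| ^ (σ - 2)) →
        Integrable (iteratedDeriv p f) ∧
          ∀ h : ℝ, h ≠ 0 →
            (∑ j ∈ Finset.range (p + 1), ∫ τ : ℝ, ‖iteratedDeriv j f τ‖) +
                |h| ^ (-σ) * ∫ τ : ℝ, ‖iteratedDeriv p f (τ + h) - iteratedDeriv p f τ‖ ≤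
              C * C₀ := by
  set φ : ℝ → ℝ := (Ioo (-3 : ℝ) 3).indicator fun x => |x| ^ (σ - 1) with hφ
  have hφi : Integrable φ := integrable_indicator_abs_rpow (by linarith) 3
  have hφ0 : 0 ≤ ∫ x, φ x :=
    integral_nonneg fun x => indicator_nonneg (fun _ _ => by positivity) x
  have hK0 : 0 ≤ ∫ u, incrementProfile σ u := integral_nonneg (incrementProfile_nonneg σ)
  refine ⟨p * 4 + (∫ x, φ x) + (∫ u, incrementProfile σ u) + 1, by positivity, ?_⟩
  intro f C₀ hC₀ _ hsupp hsmooth hlow hp₀ hp₁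
  have hd (n : ℕ) (t : ℝ) (ht : t ≠ 0) :
      HasDerivAt (iteratedDeriv n f) (iteratedDeriv (n + 1) f t) t :=
    hsmooth.hasDerivAt_iteratedDeriv isOpen_compl_singleton n ht
  have hz (n : ℕ) (t : ℝ) (ht : t ∉ Ioo (-2 : ℝ) 2) : iteratedDeriv n f t = 0 :=
    iteratedDeriv_eq_zero_of_support_subset_Ioo hsupp ht
      (hd n t fun h => ht (by simp [h])).continuousAt
  have hextend (n : ℕ) (r : ℝ)
      (h : ∀ τ ∈ Ioo (-2 : ℝ) 2 \ {0}, ‖iteratedDeriv n f τ‖ ≤ C₀ * |τ| ^ r) :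
      ∀ t ≠ 0, ‖iteratedDeriv n f t‖ ≤ C₀ * |t| ^ r := fun t ht => by
    by_cases htI : t ∈ Ioo (-2 : ℝ) 2
    · exact h t ⟨htI, ht⟩
    · rw [hz n t htI, norm_zero]
      positivity
  have hg := hextend p _ hp₀
  have hg' := hextend (p + 1) _ hp₁
  have hgφ : ∀ᵐ t, ‖iteratedDeriv p f t‖ ≤ C₀ * φ t := by
    filter_upwards [Measure.ae_ne volume 0] with t ht
    by_cases htI : t ∈ Ioo (-2 : ℝ) 2
    · rw [hφ, indicator_of_mem (by constructor <;> linarith [htI.1, htI.2])]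
      exact hg t ht
    · rw [hz p t htI, norm_zero]
      exact mul_nonneg hC₀ (indicator_nonneg (fun _ _ => by positivity) t)
  have hmeas : AEStronglyMeasurable (iteratedDeriv p f) volume := by
    rw [← restrict_compl_singleton (μ := volume) (0 : ℝ)]
    exact ContinuousOn.aestronglyMeasurable
      (fun t ht => (hd p t ht).continuousAt.continuousWithinAt) (measurableSet_singleton 0).compl
  refine ⟨(hφi.const_mul C₀).mono' hmeas hgφ, fun h hh => ?_⟩
  have hsum : ∑ j ∈ Finset.range p, ∫ τ, ‖iteratedDeriv j f τ‖ ≤ p * (4 * C₀) := by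
    refine (Finset.sum_le_card_nsmul _ _ (4 * C₀) fun j hj => ?_).trans_eq (by simp)
    have hle : ∫ τ, ‖iteratedDeriv j f τ‖ ≤ ∫ τ, (Ioo (-2 : ℝ) 2).indicator (fun _ => C₀) τ := by
      refine integral_mono_of_nonneg (.of_forall fun _ => norm_nonneg _)
        ((integrable_indicator_iff measurableSet_Ioo).2 (by simp)) ?_
      filter_upwards [Measure.ae_ne volume 0] with t ht
      by_cases htI : t ∈ Ioo (-2 : ℝ) 2
      · rw [indicator_of_mem htI]
        exact hlow j (Finset.mem_range.1 hj) t ⟨htI, ht⟩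
      · rw [indicator_of_notMem htI, hz j t htI, norm_zero]
    refine hle.trans_eq ?_
    rw [integral_indicator measurableSet_Ioo]
    norm_num
  have htop : ∫ τ, ‖iteratedDeriv p f τ‖ ≤ C₀ * ∫ x, φ x := by
    rw [← integral_const_mul]
    exact integral_mono_of_nonneg (.of_forall fun _ => norm_nonneg _) (hφi.const_mul C₀) hgφ
  have hinc := rpow_neg_mul_integral_norm_increment_le hσ0 hσ1 hC₀ hg hg' (hd p) hh
  rw [Finset.sum_range_succ]
  linarith
end
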